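/- With the fixed-pair setup in a diregular (2,k,+3)-digraph with k ≥ 3: if w ∈ T_{k-1}(v₁), then either w ∈ {u} ∪ O(u), or w ∈ T_{k-1}(u₁) with d(u₁,w) = k−1, or w ∈ T_{k-1}(u₁) with d(u₁,w) ≤ d(v₁,w). -/

import Mathlib

/-- `p` is a directed walk from `u` to `v` in the digraph with arc relation `A`,
recorded as the list of its vertices; a walk of length `l` (i.e. with `l` arcs)
is a list of `l + 1` vertices. -/
def IsWalkFrom {V : Type*} (A : V → V → Prop) (u v : V) (p : List V) : Prop :=
  p.Chain' A ∧ p.head? = some u ∧ p.getLast? = some v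

/-- A digraph is `k`-geodetic if for every ordered pair of vertices `(u, v)`
there is at most one directed path of length at most `k` from `u` to `v`. -/
def IsKGeodetic {V : Type*} (A : V → V → Prop) (k : ℕ) : Prop :=
  ∀ (u v : V) (p q : List V), IsWalkFrom A u v p → IsWalkFrom A u v q →
    p.length ≤ k + 1 → q.length ≤ k + 1 → p = q

/-- `Nout A u = N⁺(u)`, the set of out-neighbours of `u`. -/
def Nout {V : Type*} (A : V → V → Prop) (u : V) : Set V := {v | A u v}

/-- `Nin A u = N⁻(u)`, the set of in-neighbours of `u`. -/
def Nin {V : Type*} (A : V → V → Prop) (u : V) : Set V := {v | A v u}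

/-- `NIter A l u = N^l(u)`, the set of vertices reachable from `u` by a
directed path of length exactly `l`. -/
def NIter {V : Type*} (A : V → V → Prop) (l : ℕ) (u : V) : Set V :=
  {v | ∃ p : List V, IsWalkFrom A u v p ∧ p.length = l + 1}

/-- `Ball A l u = T_l(u) = N^0(u) ∪ N^1(u) ∪ ⋯ ∪ N^l(u)`, the set of vertices
at distance at most `l` from `u`. -/
def Ball {V : Type*} (A : V → V → Prop) (l : ℕ) (u : V) : Set V :=
  {v | ∃ m ≤ l, v ∈ NIter A m u}

/-- `Outliers A k u = O(u) = {v | d(u,v) ≥ k + 1}`, the outlier set of `u`. -/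
def Outliers {V : Type*} (A : V → V → Prop) (k : ℕ) (u : V) : Set V :=
  {v | v ∉ Ball A k u}

/-- A digraph is diregular with degree `d` if every vertex has out-degree `d`
and in-degree `d`. -/
def IsDiregular {V : Type*} (A : V → V → Prop) (d : ℕ) : Prop :=
  ∀ u : V, (Nout A u).ncard = d ∧ (Nin A u).ncard = d

/-- The Moore bound `M(d,k) = 1 + d + d² + ⋯ + d^k`. -/
def moore (d k : ℕ) : ℕ := ∑ i ∈ Finset.range (k + 1), d ^ i

theorem IsWalkFrom.cons {V : Type*} {A : V → V → Prop} {x y z : V} {p : List V}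
    (hxy : A x y) (hp : IsWalkFrom A y z p) : IsWalkFrom A x z (x :: p) := by
  obtain ⟨hc, hh, hl⟩ := hp
  cases p with
  | nil => simp at hh
  | cons a t =>
    obtain rfl : a = y := by simpa using hh
    exact ⟨List.isChain_cons_cons.mpr ⟨hxy, hc⟩, rfl, by simpa using hl⟩

theorem mem_NIter_zero {V : Type*} {A : V → V → Prop} {x z : V} :
    z ∈ NIter A 0 x ↔ z = x := by
  constructor
  · rintro ⟨p, ⟨-, hh, hl⟩, hlen⟩
    obtain ⟨a, rfl⟩ := List.length_eq_one_iff.mp hlen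
    simp_all
  · rintro rfl
    exact ⟨[z], ⟨List.isChain_singleton z, rfl, rfl⟩, rfl⟩

theorem mem_NIter_succ {V : Type*} {A : V → V → Prop} {n : ℕ} {x z : V} :
    z ∈ NIter A (n + 1) x ↔ ∃ y, A x y ∧ z ∈ NIter A n y := by
  constructor
  · rintro ⟨p, ⟨hc, hh, hl⟩, hlen⟩
    match p, hlen with
    | a :: b :: t, hlen =>
      obtain rfl : a = x := by simpa using hh
      obtain ⟨hab, hbt⟩ := List.isChain_cons_cons.mp hc
      exact ⟨b, hab, b :: t, ⟨hbt, rfl, by simpa using hl⟩, by simpa using hlen⟩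
  · rintro ⟨y, hxy, p, hp, hlen⟩
    exact ⟨x :: p, hp.cons hxy, by simp [hlen]⟩

theorem NIter_trans {V : Type*} {A : V → V → Prop} {m n : ℕ} {x y z : V}
    (hxy : y ∈ NIter A m x) (hyz : z ∈ NIter A n y) : z ∈ NIter A (m + n) x := by
  induction m generalizing x with
  | zero =>
    obtain rfl := mem_NIter_zero.mp hxy
    simpa using hyz
  | succ m ih =>
    obtain ⟨a, hxa, hay⟩ := mem_NIter_succ.mp hxy
    rw [Nat.add_right_comm]
    exact mem_NIter_succ.mpr ⟨a, hxa, ih hay⟩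

theorem mem_NIter_one {V : Type*} {A : V → V → Prop} {x y : V} (h : A x y) :
    y ∈ NIter A 1 x :=
  mem_NIter_succ.mpr ⟨y, h, mem_NIter_zero.mpr rfl⟩

namespace IsKGeodetic

variable {V : Type*} {A : V → V → Prop} {k : ℕ}

theorem length_eq (hgeo : IsKGeodetic A k) {m n : ℕ} {x z : V}
    (hm : z ∈ NIter A m x) (hn : z ∈ NIter A n x) (hmk : m ≤ k) (hnk : n ≤ k) : m = n := by
  obtain ⟨p, hp, hpl⟩ := hm
  obtain ⟨q, hq, hql⟩ := hn
  have := hgeo x z p q hp hq (by omega) (by omega)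
  subst this
  omega

theorem branch_eq (hgeo : IsKGeodetic A k) {m n : ℕ} {x y y' z : V}
    (hy : A x y) (hy' : A x y') (hm : z ∈ NIter A m y) (hn : z ∈ NIter A n y')
    (hmk : m < k) (hnk : n < k) : y = y' := by
  obtain ⟨p, hp, hpl⟩ := hm
  obtain ⟨q, hq, hql⟩ := hn
  have hpq := hgeo x z _ _ (hp.cons hy) (hq.cons hy') (by simp; omega) (by simp; omega)
  obtain rfl : p = q := (List.cons.inj hpq).2
  exact Option.some.inj (hp.2.1.symm.trans hq.2.1)

theorem ncard_NIter [Finite V] (hgeo : IsKGeodetic A k) (hreg : IsDiregular A 2) {n : ℕ}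
    (hn : n ≤ k) (x : V) : (NIter A n x).ncard = 2 ^ n := by
  induction n generalizing x with
  | zero =>
    have : NIter A 0 x = {x} := Set.ext fun z => mem_NIter_zero
    simp [this]
  | succ n ih =>
    obtain ⟨y, y', hne, hN⟩ := Set.ncard_eq_two.mp (hreg x).1
    have hmem : ∀ z, A x z ↔ z = y ∨ z = y' := fun z => Set.ext_iff.mp hN z
    have hunion : NIter A (n + 1) x = NIter A n y ∪ NIter A n y' := by
      ext z
      simp [mem_NIter_succ, hmem]
    have hdisj : Disjoint (NIter A n y) (NIter A n y') :=
      Set.disjoint_left.mpr fun z h h' =>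
        hne (hgeo.branch_eq ((hmem y).mpr (.inl rfl)) ((hmem y').mpr (.inr rfl)) h h' hn hn)
    rw [hunion, Set.ncard_union_eq hdisj, ih (by omega), ih (by omega)]
    ring

theorem ncard_Ball [Finite V] (hgeo : IsKGeodetic A k) (hreg : IsDiregular A 2) {n : ℕ}
    (hn : n ≤ k) (x : V) : (Ball A n x).ncard = moore 2 n := by
  induction n with
  | zero =>
    have : Ball A 0 x = {x} := by
      ext z
      simp [Ball, mem_NIter_zero]
    simp [this, moore]
  | succ n ih =>
    have hunion : Ball A (n + 1) x = Ball A n x ∪ NIter A (n + 1) x := by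
      ext z
      constructor
      · rintro ⟨m, hm, hz⟩
        rcases Nat.le_succ_iff.mp hm with h | rfl
        · exact .inl ⟨m, h, hz⟩
        · exact .inr hz
      · rintro (⟨m, hm, hz⟩ | hz)
        · exact ⟨m, by omega, hz⟩
        · exact ⟨n + 1, le_rfl, hz⟩
    have hdisj : Disjoint (Ball A n x) (NIter A (n + 1) x) := by
      refine Set.disjoint_left.mpr ?_
      rintro z ⟨m, hm, hz⟩ hz'
      have := hgeo.length_eq hz hz' (by omega) hn
      omega
    rw [hunion, Set.ncard_union_eq hdisj, ih (by omega), hgeo.ncard_NIter hreg hn, moore, moore,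
      Finset.sum_range_succ _ (n + 1)]

theorem ncard_Outliers [Fintype V] (hgeo : IsKGeodetic A k) (hreg : IsDiregular A 2) {e : ℕ}
    (hcard : Fintype.card V = moore 2 k + e) (x : V) : (Outliers A k x).ncard = e := by
  have h := Set.ncard_add_ncard_compl (Ball A k x)
  rw [hgeo.ncard_Ball hreg le_rfl, Nat.card_eq_fintype_card, hcard] at h
  exact Nat.add_left_cancel h

end IsKGeodetic

/-- Fixed-pair setup, `k ≥ 3`: if `w ∈ T_{k-1}(v₁)` (say `d(v₁,w) = l`),
then `w ∈ {u} ∪ O(u)`, or `w ∈ N^{k-1}(u₁)`, or `w ∈ T_{k-1}(u₁)` with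
`d(u₁,w) ≤ d(v₁,w)`. -/
theorem contraction_corollary {V : Type*} [Fintype V] (A : V → V → Prop) (k : ℕ)
    (u v u₁ u₂ v₁ : V)
    (hirr : Irreflexive A) (hreg : IsDiregular A 2) (hgeo : IsKGeodetic A k)
    (hcard : Fintype.card V = moore 2 k + 3)
    (hu : Nout A u = {u₁, u₂}) (hv : Nout A v = {v₁, u₂}) (huv : u₁ ≠ v₁)
    (hk : 3 ≤ k) :
    ∀ (w : V) (l : ℕ), l ≤ k - 1 → w ∈ NIter A l v₁ →
      w ∈ ({u} : Set V) ∪ Outliers A k u ∨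
        w ∈ NIter A (k - 1) u₁ ∨
        ∃ m ≤ l, w ∈ NIter A m u₁ := by
  have hmu : ∀ z, A u z ↔ z = u₁ ∨ z = u₂ := fun z => Set.ext_iff.mp hu z
  have hmv : ∀ z, A v z ↔ z = v₁ ∨ z = u₂ := fun z => Set.ext_iff.mp hv z
  have huu₁ : A u u₁ := (hmu _).mpr (.inl rfl)
  have huu₂ : A u u₂ := (hmu _).mpr (.inr rfl)
  have hvv₁ : A v v₁ := (hmv _).mpr (.inl rfl)
  have hvu₂ : A v u₂ := (hmv _).mpr (.inr rfl)
  have hne : v₁ ≠ u₂ := by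
    rintro rfl
    have := (hreg v).1
    simp [hv] at this
  have split : ∀ z ∉ ({u} : Set V) ∪ Outliers A k u,
      (∃ m < k, z ∈ NIter A m u₁) ∨ ∃ m < k, z ∈ NIter A m u₂ := by
    intro z hz
    obtain ⟨hzu, hzO⟩ := not_or.mp hz
    obtain ⟨m, hm, hzm⟩ := not_not.mp hzO
    cases m with
    | zero => exact absurd (mem_NIter_zero.mp hzm) hzu
    | succ m =>
      obtain ⟨y, hy, hzy⟩ := mem_NIter_succ.mp hzm
      rcases (hmu y).mp hy with rfl | rfl
      · exact .inl ⟨m, hm, hzy⟩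
      · exact .inr ⟨m, hm, hzy⟩
  have split_v₁ : ∀ z n, n < k → z ∈ NIter A n v₁ → z ∉ ({u} : Set V) ∪ Outliers A k u →
      ∃ m < k, z ∈ NIter A m u₁ := by
    intro z n hn hzn hz
    rcases split z hz with h | ⟨m, hm, hzm⟩
    · exact h
    · exact absurd (hgeo.branch_eq hvv₁ hvu₂ hzn hzm hn hm) hne
  intro w l hl hwl
  by_contra! hcon
  obtain ⟨hw, hwk, hwm⟩ := hcon
  obtain ⟨m, hmk, hm⟩ := split_v₁ w l (by omega) hwl hw
  have hlm : l < m := by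
    by_contra! h
    exact hwm m h hm
  have hmk' : m + 2 ≤ k := by
    have : m ≠ k - 1 := by
      rintro rfl
      exact hwk hm
    omega
  have hsub : NIter A (k - m) w ⊆ {u} ∪ Outliers A k u := by
    intro z hz
    by_contra hzn
    obtain ⟨j, hj, hzj⟩ := split_v₁ z (l + (k - m)) (by omega) (NIter_trans hwl hz) hzn
    have := hgeo.length_eq hzj (NIter_trans hm hz) (by omega) (by omega)
    omega
  -- Both sets have four elements.
  have heq : NIter A (k - m) w = {u} ∪ Outliers A k u := by
    refine Set.eq_of_subset_of_ncard_le hsub ?_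
    calc (({u} : Set V) ∪ Outliers A k u).ncard
        ≤ ({u} : Set V).ncard + (Outliers A k u).ncard := Set.ncard_union_le _ _
      _ = 2 ^ 2 := by norm_num [hgeo.ncard_Outliers hreg hcard]
      _ ≤ 2 ^ (k - m) := Nat.pow_le_pow_right two_pos (by omega)
      _ = (NIter A (k - m) w).ncard := (hgeo.ncard_NIter hreg (by omega) w).symm
  have hfar : ∀ z ∈ ({u} : Set V) ∪ Outliers A k u, z ∈ NIter A (l + (k - m)) v₁ :=
    fun z hz => NIter_trans hwl (heq ▸ hz)
  have hv_cycle : ∀ n, 0 < n → n ≤ k → v ∉ NIter A n v := fun n hn hnk h =>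
    hn.ne (hgeo.length_eq (mem_NIter_zero.mpr rfl) h (Nat.zero_le k) hnk)
  have hvn : v ∉ ({u} : Set V) ∪ Outliers A k u := fun h =>
    hv_cycle _ (Nat.succ_pos _) (by omega) (mem_NIter_succ.mpr ⟨v₁, hvv₁, hfar v h⟩)
  have hv₁n : v₁ ∉ ({u} : Set V) ∪ Outliers A k u := by
    intro h
    have := hgeo.length_eq (hfar v₁ h) (mem_NIter_zero.mpr rfl) (by omega) (Nat.zero_le k)
    omega
  -- Hence `v` lies at distance exactly `k - 1` from `u₁`, and `v₁` cannot be within `k - 1`.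
  obtain ⟨j, hj, hvj⟩ | ⟨j, hj, hvj⟩ := split v hvn
  · have hu₂ : u₂ ∈ NIter A (j + 1 + 1) u :=
      mem_NIter_succ.mpr ⟨u₁, huu₁, NIter_trans hvj (mem_NIter_one hvu₂)⟩
    have hjk : j + 1 = k := by
      by_contra hjk
      have := hgeo.length_eq hu₂ (mem_NIter_one huu₂) (by omega) (by omega)
      omega
    obtain ⟨i, hi, hv₁i⟩ := split_v₁ v₁ 0 (by omega) (mem_NIter_zero.mpr rfl) hv₁n
    have := hgeo.length_eq hv₁i (NIter_trans hvj (mem_NIter_one hvv₁)) hi.le hj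
    omega
  · exact hv_cycle _ (Nat.succ_pos _) hj (mem_NIter_succ.mpr ⟨u₂, hvu₂, hvj⟩)
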